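/- arXiv:1611.01554 — 4 statements merged into one kernel-verified Lean document; each statement's English description precedes it below -/
import Mathlib

section
/- Let V be a finite-dimensional real inner product space with inner product η. Suppose V = V_1 ⊕ ⋯ ⊕ V_r and V = V'_1 ⊕ ⋯ ⊕ V'_s are two orthogonal direct sum decompositions of V into nonzero pairwise orthogonal subspaces, with associated projected forms η_α(X,Y) = η(P_α X, P_α Y) and η'_α(X,Y) = η(P'_α X, P'_α Y), where P_α (resp. P'_α) is the orthogonal projection onto V_α (resp. V'_α). If the linear span of {η_1,…,η_r} inside the space of symmetric bilinear forms on V equals the linear span of {η'_1,…,η'_s}, then r = s and there exists a permutation σ of {1,…,r} such that V'_α = V_{σ(α)} for every α. (This is the uniqueness content of Proposition 1: the forms η_α and the orthogonal decomposition can be reconstructed, up to a permutation, from any basis of the span of {η_1,…,η_r}.) -/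
open scoped InnerProductSpace

section

variable {V : Type*} [NormedAddCommGroup V] [InnerProductSpace ℝ V]

theorem inner_proj_proj {W : Submodule ℝ V} {P : V →ₗ[ℝ] V} (hmem : ∀ x, P x ∈ W)
    (horth : ∀ x, x - P x ∈ Wᗮ) (x y : V) : ⟪P x, P y⟫_ℝ = ⟪P x, y⟫_ℝ := by
  have h := Submodule.inner_right_of_mem_orthogonal (hmem x) (horth y)
  rw [inner_sub_right] at h
  linarith

theorem proj_eq_self {W : Submodule ℝ V} {P : V →ₗ[ℝ] V} (hmem : ∀ x, P x ∈ W)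
    (horth : ∀ x, x - P x ∈ Wᗮ) {x : V} (hx : x ∈ W) : P x = x := by
  have h := Submodule.inner_right_of_mem_orthogonal (W.sub_mem hx (hmem x)) (horth x)
  exact (sub_eq_zero.mp (inner_self_eq_zero.mp h)).symm

theorem proj_eq_zero {W : Submodule ℝ V} {P : V →ₗ[ℝ] V} (hmem : ∀ x, P x ∈ W)
    (horth : ∀ x, x - P x ∈ Wᗮ) {x : V} (hx : x ∈ Wᗮ) : P x = 0 := by
  have h : P x ∈ Wᗮ := by simpa using Wᗮ.sub_mem hx (horth x)
  exact inner_self_eq_zero.mp (Submodule.inner_right_of_mem_orthogonal (hmem x) h)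

/-- Every form in the span of the projected forms is a multiple of the inner product
on each summand. -/
theorem exists_eq_mul_inner_of_mem_span {ι : Type*} {W : ι → Submodule ℝ V}
    (hW : ∀ i j, i ≠ j → ∀ x ∈ W i, ∀ y ∈ W j, ⟪x, y⟫_ℝ = 0)
    {P : ι → V →ₗ[ℝ] V} (hmem : ∀ i x, P i x ∈ W i) (horth : ∀ i x, x - P i x ∈ (W i)ᗮ)
    {η : ι → V →ₗ[ℝ] V →ₗ[ℝ] ℝ} (hη : ∀ i x y, η i x y = ⟪P i x, P i y⟫_ℝ)
    {B : V →ₗ[ℝ] V →ₗ[ℝ] ℝ} (hB : B ∈ Submodule.span ℝ (Set.range η)) (i : ι) :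
    ∃ c : ℝ, ∀ x ∈ W i, ∀ y, B x y = c * ⟪x, y⟫_ℝ := by
  induction hB using Submodule.span_induction with
  | mem B hB =>
    obtain ⟨j, rfl⟩ := hB
    by_cases hij : j = i
    · subst hij
      refine ⟨1, fun x hx y => ?_⟩
      rw [hη, inner_proj_proj (hmem j) (horth j), proj_eq_self (hmem j) (horth j) hx, one_mul]
    · refine ⟨0, fun x hx y => ?_⟩
      have hx' : x ∈ (W j)ᗮ := fun z hz => hW j i hij z hz x hx
      rw [hη, proj_eq_zero (hmem j) (horth j) hx', inner_zero_left, zero_mul]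
  | zero => exact ⟨0, fun x _ y => by simp⟩
  | add B C _ _ hB hC =>
    obtain ⟨b, hb⟩ := hB
    obtain ⟨c, hc⟩ := hC
    refine ⟨b + c, fun x hx y => ?_⟩
    rw [LinearMap.add_apply, LinearMap.add_apply, hb x hx, hc x hx, add_mul]
  | smul a B _ hB =>
    obtain ⟨b, hb⟩ := hB
    refine ⟨a * b, fun x hx y => ?_⟩
    rw [LinearMap.smul_apply, LinearMap.smul_apply, hb x hx, smul_eq_mul, mul_assoc]

/-- A subspace on which the projected form of `W` is a multiple of the inner product
is contained in `W` or orthogonal to it. -/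
theorem le_or_le_orthogonal_of_eq_mul_inner {U W : Submodule ℝ V} {P : V →ₗ[ℝ] V}
    (hmem : ∀ x, P x ∈ W) (horth : ∀ x, x - P x ∈ Wᗮ) {c : ℝ}
    (hc : ∀ x ∈ U, ∀ y, ⟪P x, P y⟫_ℝ = c * ⟪x, y⟫_ℝ) : U ≤ W ∨ U ≤ Wᗮ := by
  have key : ∀ x ∈ U, P x = c • x := fun x hx => ext_inner_right ℝ fun y => by
    rw [← inner_proj_proj hmem horth, hc x hx, real_inner_smul_left]
  by_cases h0 : c = 0
  · right
    intro x hx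
    simpa [key x hx, h0] using horth x
  · left
    intro x hx
    have h := hmem x
    rwa [key x hx, Submodule.smul_mem_iff W h0] at h

theorem exists_le_of_span_le {ι κ : Type*} {U : ι → Submodule ℝ V} {W : κ → Submodule ℝ V}
    (hU : ∀ i j, i ≠ j → ∀ x ∈ U i, ∀ y ∈ U j, ⟪x, y⟫_ℝ = 0)
    (hU_ne : ∀ i, U i ≠ ⊥) (hW : ⨆ k, W k = ⊤)
    {P : ι → V →ₗ[ℝ] V} (hP_mem : ∀ i x, P i x ∈ U i) (hP_orth : ∀ i x, x - P i x ∈ (U i)ᗮ)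
    {Q : κ → V →ₗ[ℝ] V} (hQ_mem : ∀ k x, Q k x ∈ W k) (hQ_orth : ∀ k x, x - Q k x ∈ (W k)ᗮ)
    {η : ι → V →ₗ[ℝ] V →ₗ[ℝ] ℝ} (hη : ∀ i x y, η i x y = ⟪P i x, P i y⟫_ℝ)
    {θ : κ → V →ₗ[ℝ] V →ₗ[ℝ] ℝ} (hθ : ∀ k x y, θ k x y = ⟪Q k x, Q k y⟫_ℝ)
    (hspan : Submodule.span ℝ (Set.range θ) ≤ Submodule.span ℝ (Set.range η)) (i : ι) :
    ∃ k, U i ≤ W k := by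
  by_contra! hnot
  refine hU_ne i (le_bot_iff.mp ?_)
  have h : U i ≤ ⨅ k, (W k)ᗮ := le_iInf fun k => by
    obtain ⟨c, hc⟩ := exists_eq_mul_inner_of_mem_span hU hP_mem hP_orth hη
      (hspan (Submodule.subset_span ⟨k, rfl⟩)) i
    exact (le_or_le_orthogonal_of_eq_mul_inner (hQ_mem k) (hQ_orth k)
      fun x hx y => (hθ k x y).symm.trans (hc x hx y)).resolve_left (hnot k)
  rwa [Submodule.iInf_orthogonal, hW, Submodule.top_orthogonal_eq_bot] at h

theorem eq_of_le_of_pairwise_orthogonal {ι : Type*} {U : ι → Submodule ℝ V}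
    (hU : ∀ i j, i ≠ j → ∀ x ∈ U i, ∀ y ∈ U j, ⟪x, y⟫_ℝ = 0)
    (hU_ne : ∀ i, U i ≠ ⊥) {i j : ι} (hij : U i ≤ U j) : i = j := by
  by_contra hne
  exact hU_ne i ((Submodule.eq_bot_iff _).mpr fun x hx =>
    inner_self_eq_zero.mp (hU i j hne x hx x (hij hx)))

end

/-- Uniqueness content of Proposition 1: if two orthogonal direct sum decompositions
of a finite-dimensional real inner product space into nonzero pairwise orthogonal
subspaces have projected forms with the same linear span, then the decompositions
agree up to a permutation. -/
theorem deRham_decomposition_unique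
    {V : Type*} [NormedAddCommGroup V] [InnerProductSpace ℝ V] [FiniteDimensional ℝ V]
    {r s : ℕ}
    (V₁ : Fin r → Submodule ℝ V) (V₂ : Fin s → Submodule ℝ V)
    (hint₁ : DirectSum.IsInternal V₁) (hint₂ : DirectSum.IsInternal V₂)
    (hne₁ : ∀ α, V₁ α ≠ ⊥) (hne₂ : ∀ α, V₂ α ≠ ⊥)
    (horth₁ : ∀ α β, α ≠ β → ∀ x ∈ V₁ α, ∀ y ∈ V₁ β, ⟪x, y⟫_ℝ = 0)
    (horth₂ : ∀ α β, α ≠ β → ∀ x ∈ V₂ α, ∀ y ∈ V₂ β, ⟪x, y⟫_ℝ = 0)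
    -- the orthogonal projections onto the subspaces
    (P₁ : Fin r → V →ₗ[ℝ] V) (P₂ : Fin s → V →ₗ[ℝ] V)
    (hP₁mem : ∀ α x, P₁ α x ∈ V₁ α) (hP₁orth : ∀ α x, x - P₁ α x ∈ (V₁ α)ᗮ)
    (hP₂mem : ∀ α x, P₂ α x ∈ V₂ α) (hP₂orth : ∀ α x, x - P₂ α x ∈ (V₂ α)ᗮ)
    -- the projected symmetric bilinear forms
    (η₁ : Fin r → V →ₗ[ℝ] V →ₗ[ℝ] ℝ) (η₂ : Fin s → V →ₗ[ℝ] V →ₗ[ℝ] ℝ)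
    (hη₁ : ∀ α x y, η₁ α x y = ⟪P₁ α x, P₁ α y⟫_ℝ)
    (hη₂ : ∀ α x y, η₂ α x y = ⟪P₂ α x, P₂ α y⟫_ℝ)
    (hspan : Submodule.span ℝ (Set.range η₁) = Submodule.span ℝ (Set.range η₂)) :
    r = s ∧ ∃ σ : Fin s ≃ Fin r, ∀ α, V₂ α = V₁ (σ α) := by
  choose f hf using exists_le_of_span_le horth₁ hne₁ hint₂.submodule_iSup_eq_top
    hP₁mem hP₁orth hP₂mem hP₂orth hη₁ hη₂ hspan.ge
  choose g hg using exists_le_of_span_le horth₂ hne₂ hint₁.submodule_iSup_eq_top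
    hP₂mem hP₂orth hP₁mem hP₁orth hη₂ hη₁ hspan.le
  have hgf : ∀ α, g (f α) = α := fun α =>
    (eq_of_le_of_pairwise_orthogonal horth₁ hne₁ ((hf α).trans (hg (f α)))).symm
  have hfg : ∀ α, f (g α) = α := fun α =>
    (eq_of_le_of_pairwise_orthogonal horth₂ hne₂ ((hg α).trans (hf (g α)))).symm
  let σ : Fin s ≃ Fin r := ⟨g, f, hfg, hgf⟩
  refine ⟨(Fin.equiv_iff_eq.mp ⟨σ⟩).symm, σ, fun α => le_antisymm (hg α) ?_⟩
  exact (hf (g α)).trans_eq (congrArg V₂ (hfg α))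
end

section
/- (Lemma 1, second case.) Let V be a finite-dimensional real vector space with a symmetric bilinear form η, and let V = V_1 ⊕ ⋯ ⊕ V_r be a direct sum decomposition into pairwise η-orthogonal subspaces such that the restriction of η to each V_β is nondegenerate. Let p ∈ V_r be a nonzero vector with η(p,p) = 0 and let θ = η(p,·). Let C_1, …, C_{r−1}, C_{r+1} be real numbers with C_{r+1} ≠ 0, and set η̄ = Σ_{β=1}^{r−1} C_β η_β + C_{r+1} θ⊗θ, where η_β are the projected forms. Then the kernel of η̄ equals (⊕_{1 ≤ β ≤ r−1, C_β = 0} V_β) ⊕ {X ∈ V_r : θ(X) = 0}, and the radical of the restriction of η to the kernel of η̄ equals the line ℝp. -/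
section OrthogonalDecomposition

variable {V ι : Type*} [AddCommGroup V] [Module ℝ V] [Fintype ι]
  {η : V →ₗ[ℝ] V →ₗ[ℝ] ℝ} {W : ι → Submodule ℝ V} {P : ι → V →ₗ[ℝ] V}

/-- Pairing with an element of a summand only sees the component in that summand. -/
theorem apply_component_of_mem
    (horth : ∀ α β, α ≠ β → ∀ x ∈ W α, ∀ y ∈ W β, η x y = 0)
    (hPmem : ∀ α x, P α x ∈ W α) (hPsum : ∀ x, ∑ α, P α x = x)
    {β : ι} (x : V) {y : V} (hy : y ∈ W β) : η (P β x) y = η x y := by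
  conv_rhs => rw [← hPsum x, map_sum, LinearMap.sum_apply]
  exact (Finset.sum_eq_single_of_mem β (Finset.mem_univ β)
    fun α _ h => horth α β h _ (hPmem α x) y hy).symm

/-- A component vanishes as soon as the vector is orthogonal to the corresponding summand. -/
theorem component_eq_zero_of_orthogonal
    (horth : ∀ α β, α ≠ β → ∀ x ∈ W α, ∀ y ∈ W β, η x y = 0)
    (hndres : ∀ β, ∀ x ∈ W β, (∀ y ∈ W β, η x y = 0) → x = 0)
    (hPmem : ∀ α x, P α x ∈ W α) (hPsum : ∀ x, ∑ α, P α x = x)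
    {β : ι} {x : V} (hx : ∀ y ∈ W β, η x y = 0) : P β x = 0 :=
  hndres β _ (hPmem β x) fun y hy => by
    rw [apply_component_of_mem horth hPmem hPsum x hy, hx y hy]

theorem component_eq_zero_of_mem_of_ne
    (horth : ∀ α β, α ≠ β → ∀ x ∈ W α, ∀ y ∈ W β, η x y = 0)
    (hndres : ∀ β, ∀ x ∈ W β, (∀ y ∈ W β, η x y = 0) → x = 0)
    (hPmem : ∀ α x, P α x ∈ W α) (hPsum : ∀ x, ∑ α, P α x = x)
    {α β : ι} (h : α ≠ β) {x : V} (hx : x ∈ W α) : P β x = 0 :=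
  component_eq_zero_of_orthogonal horth hndres hPmem hPsum fun y hy => horth α β h x hx y hy

theorem component_eq_self_of_mem
    (horth : ∀ α β, α ≠ β → ∀ x ∈ W α, ∀ y ∈ W β, η x y = 0)
    (hndres : ∀ β, ∀ x ∈ W β, (∀ y ∈ W β, η x y = 0) → x = 0)
    (hPmem : ∀ α x, P α x ∈ W α) (hPsum : ∀ x, ∑ α, P α x = x)
    {β : ι} {x : V} (hx : x ∈ W β) : P β x = x := by
  conv_rhs => rw [← hPsum x]
  exact (Finset.sum_eq_single_of_mem β (Finset.mem_univ β) fun α _ h =>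
    component_eq_zero_of_mem_of_ne horth hndres hPmem hPsum h.symm hx).symm

end OrthogonalDecomposition


/-- Lemma 1, second case: for `η̄ = ∑_{β<r} C_β η_β + C_{r+1} θ⊗θ` with
`C_{r+1} ≠ 0`, the kernel of `η̄` is `(⊕_{C_β = 0} V_β) ⊕ {X ∈ V_r | θ(X) = 0}`,
and the radical of the restriction of `η` to this kernel is the line `ℝ p`.
Here the subspaces are indexed by `Fin (n+1)`, `Fin.last n` playing the role of `r`
and `β.castSucc` for `β : Fin n` the roles of `1, …, r−1`. -/
theorem ker_combination_with_theta_term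
    {V : Type*} [AddCommGroup V] [Module ℝ V] [FiniteDimensional ℝ V]
    (η : V →ₗ[ℝ] V →ₗ[ℝ] ℝ)
    (hsymm : ∀ x y, η x y = η y x)
    {n : ℕ}
    (V_ : Fin (n + 1) → Submodule ℝ V)
    (hint : DirectSum.IsInternal V_)
    (horth : ∀ α β, α ≠ β → ∀ x ∈ V_ α, ∀ y ∈ V_ β, η x y = 0)
    (hndres : ∀ β, ∀ x ∈ V_ β, (∀ y ∈ V_ β, η x y = 0) → x = 0)
    -- the projections onto the subspaces along the decomposition
    (P : Fin (n + 1) → V →ₗ[ℝ] V)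
    (hPmem : ∀ α x, P α x ∈ V_ α) (hPsum : ∀ x, ∑ α, P α x = x)
    -- the light-like vector `p` in the last subspace
    (p : V) (hp : p ∈ V_ (Fin.last n)) (hp0 : p ≠ 0) (hpp : η p p = 0)
    -- the coefficients and the combination `η̄`
    (C : Fin n → ℝ) (Cθ : ℝ) (hCθ : Cθ ≠ 0)
    (ηb : V →ₗ[ℝ] V →ₗ[ℝ] ℝ)
    (hηb : ∀ x y, ηb x y =
      (∑ β : Fin n, C β * η (P β.castSucc x) (P β.castSucc y)) + Cθ * (η p x * η p y)) :
    LinearMap.ker ηb =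
        (⨆ β ∈ {β : Fin n | C β = 0}, V_ β.castSucc) ⊔
          (V_ (Fin.last n) ⊓ LinearMap.ker (η p)) ∧
      {x : V | x ∈ LinearMap.ker ηb ∧ ∀ y ∈ LinearMap.ker ηb, η x y = 0} =
        ↑(Submodule.span ℝ {p}) := by
  have hPself : ∀ {β x}, x ∈ V_ β → P β x = x := fun hx =>
    component_eq_self_of_mem horth hndres hPmem hPsum hx
  have hPne : ∀ {α β x}, α ≠ β → x ∈ V_ α → P β x = 0 := fun h hx =>
    component_eq_zero_of_mem_of_ne horth hndres hPmem hPsum h hx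
  have hne : ∀ β : Fin n, Fin.last n ≠ β.castSucc := fun β => (Fin.castSucc_lt_last β).ne'
  have hdecomp : ∀ x, x = ∑ β : Fin n, P β.castSucc x + P (Fin.last n) x := fun x => by
    rw [← Fin.sum_univ_castSucc (fun α => P α x), hPsum]
  obtain ⟨q, hq, hpq⟩ : ∃ q ∈ V_ (Fin.last n), η p q = 1 := by
    obtain ⟨y, hy, hpy⟩ : ∃ y ∈ V_ (Fin.last n), η p y ≠ 0 := by
      by_contra! h
      exact hp0 (hndres _ p hp h)
    exact ⟨(η p y)⁻¹ • y, Submodule.smul_mem _ _ hy, by simp [hpy]⟩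
  have hker : ∀ x, x ∈ LinearMap.ker ηb ↔
      (∀ β : Fin n, C β ≠ 0 → P β.castSucc x = 0) ∧ η p x = 0 := by
    intro x
    rw [LinearMap.mem_ker]
    constructor
    · intro hx
      have hx' : ∀ y, ηb x y = 0 := fun y => by rw [hx, LinearMap.zero_apply]
      refine ⟨fun β hβ => hndres _ _ (hPmem _ x) fun y hy => ?_, ?_⟩
      · have h := hx' y
        rw [hηb, horth _ _ (hne β) p hp y hy, Finset.sum_eq_single_of_mem β (Finset.mem_univ β),
          hPself hy] at h
        · simpa [hβ] using h
        · intro γ _ hγ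
          rw [hPne (fun e => hγ (Fin.castSucc_injective n e).symm) hy, map_zero, mul_zero]
      · have h := hx' q
        rw [hηb, hpq, Finset.sum_eq_zero fun β _ => by
          rw [hPne (hne β) hq, map_zero, mul_zero]] at h
        simpa [hCθ] using h
    · rintro ⟨hx, hpx⟩
      ext y
      rw [hηb, hpx, Finset.sum_eq_zero fun β _ => ?_]
      · simp
      · by_cases hβ : C β = 0
        · rw [hβ, zero_mul]
        · rw [hx β hβ, map_zero, LinearMap.zero_apply, mul_zero]
  have hker_of_mem : ∀ {β : Fin n}, C β = 0 → V_ β.castSucc ≤ LinearMap.ker ηb := by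
    intro β hβ y hy
    refine (hker y).2 ⟨fun γ hγ => hPne (fun e => hγ ?_) hy, horth _ _ (hne β) p hp y hy⟩
    rwa [← Fin.castSucc_injective n e]
  have hker_of_last : ∀ {y}, y ∈ V_ (Fin.last n) → η p y = 0 → y ∈ LinearMap.ker ηb :=
    fun hy hpy => (hker _).2 ⟨fun β _ => hPne (hne β) hy, hpy⟩
  refine ⟨le_antisymm (fun x hx => ?_) ?_, Set.Subset.antisymm ?_ ?_⟩
  · obtain ⟨hx0, hpx⟩ := (hker x).1 hx
    rw [hdecomp x]
    refine Submodule.add_mem_sup (Submodule.sum_mem _ fun β _ => ?_) ⟨hPmem _ x, ?_⟩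
    · by_cases hβ : C β = 0
      · exact Submodule.mem_iSup_of_mem β (Submodule.mem_iSup_of_mem hβ (hPmem _ x))
      · rw [hx0 β hβ]
        exact Submodule.zero_mem _
    · change η p (P (Fin.last n) x) = 0
      rw [hsymm, apply_component_of_mem horth hPmem hPsum x hp, hsymm, hpx]
  · exact sup_le (iSup₂_le fun β hβ => hker_of_mem hβ) fun y hy => hker_of_last hy.1 hy.2
  · rintro x ⟨hx, hrad⟩
    have hxlast : x ∈ V_ (Fin.last n) := by
      rw [hdecomp x, Finset.sum_eq_zero fun β _ => ?_, zero_add]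
      · exact hPmem _ x
      · by_cases hβ : C β = 0
        · exact component_eq_zero_of_orthogonal horth hndres hPmem hPsum
            fun y hy => hrad y (hker_of_mem hβ hy)
        · exact ((hker x).1 hx).1 β hβ
    refine Submodule.mem_span_singleton.2 ⟨η x q, (sub_eq_zero.1 (hndres _ (x - η x q • p)
      (Submodule.sub_mem _ hxlast (Submodule.smul_mem _ _ hp)) fun y hy => ?_)).symm⟩
    have h := hrad (y - η p y • q) (hker_of_last
      (Submodule.sub_mem _ hy (Submodule.smul_mem _ _ hq)) (by simp [hpq]))
    simp only [map_sub, map_smul, LinearMap.sub_apply, LinearMap.smul_apply, smul_eq_mul] at h ⊢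
    linarith
  · intro x hx
    obtain ⟨c, rfl⟩ := Submodule.mem_span_singleton.1 hx
    refine ⟨Submodule.smul_mem _ _ (hker_of_last hp hpp), fun y hy => ?_⟩
    rw [map_smul, LinearMap.smul_apply, ((hker y).1 hy).2, smul_zero]
end

section
/- (Lemma 3.) Let V be a finite-dimensional real vector space with a nondegenerate symmetric bilinear form η, and let V = V_1 ⊕ ⋯ ⊕ V_r be a direct sum decomposition into pairwise η-orthogonal subspaces such that the restriction of η to each V_β is nondegenerate. Let p ∈ V_r be a nonzero vector with η(p,p) = 0 and θ = η(p,·). For α = 2, …, r+1 let η̄_α = Σ_{β=1}^{r−1} C_{βα} η_β + C_{r+1 α} θ⊗θ with real coefficients C_{βα}, assume that for every β with 1 ≤ β ≤ r−1 there exists α with C_{βα} ≠ 0, and let U = V_1 ⊕ ⋯ ⊕ V_{r−1} ⊕ ℝp. Then the set {X ∈ V : η̄_α(X,Y) = 0 for all 2 ≤ α ≤ r+1 and all Y ∈ U} equals V_r. -/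
/-- Lemma 3: with `U = V_1 ⊕ ⋯ ⊕ V_{r−1} ⊕ ℝ p`, the set of vectors `X` with
`η̄_α (X, Y) = 0` for all `α` and all `Y ∈ U` coincides with `V_r`.
Here the subspaces are indexed by `Fin (n+1)`, `Fin.last n` playing the role of `r`
and `β.castSucc` for `β : Fin n` the roles of `1, …, r−1`; the forms `η̄_α` are
indexed by `α : Fin (n+1)` (playing the roles of `2, …, r+1`). -/
theorem wu_lemma_three
    {V : Type*} [AddCommGroup V] [Module ℝ V] [FiniteDimensional ℝ V]
    (η : V →ₗ[ℝ] V →ₗ[ℝ] ℝ)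
    (hsymm : ∀ x y, η x y = η y x)
    (hnd : ∀ x, (∀ y, η x y = 0) → x = 0)
    {n : ℕ}
    (V_ : Fin (n + 1) → Submodule ℝ V)
    (hint : DirectSum.IsInternal V_)
    (horth : ∀ α β, α ≠ β → ∀ x ∈ V_ α, ∀ y ∈ V_ β, η x y = 0)
    (hndres : ∀ β, ∀ x ∈ V_ β, (∀ y ∈ V_ β, η x y = 0) → x = 0)
    -- the projections onto the subspaces along the decomposition
    (P : Fin (n + 1) → V →ₗ[ℝ] V)
    (hPmem : ∀ α x, P α x ∈ V_ α) (hPsum : ∀ x, ∑ α, P α x = x)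
    -- the light-like vector `p` in the last subspace
    (p : V) (hp : p ∈ V_ (Fin.last n)) (hp0 : p ≠ 0) (hpp : η p p = 0)
    -- the coefficients and the combinations `η̄_α`
    (Cc : Fin n → Fin (n + 1) → ℝ) (Cθ : Fin (n + 1) → ℝ)
    (ηbar : Fin (n + 1) → V →ₗ[ℝ] V →ₗ[ℝ] ℝ)
    (hηbar : ∀ α x y, ηbar α x y =
      (∑ β : Fin n, Cc β α * η (P β.castSucc x) (P β.castSucc y)) +
        Cθ α * (η p x * η p y))
    (hC : ∀ β : Fin n, ∃ α, Cc β α ≠ 0)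
    (U : Submodule ℝ V)
    (hU : U = (⨆ β : Fin n, V_ β.castSucc) ⊔ Submodule.span ℝ {p}) :
    {x : V | ∀ α, ∀ y ∈ U, ηbar α x y = 0} = ↑(V_ (Fin.last n)) := by
  have hPη : ∀ γ x, ∀ z ∈ V_ γ, η (P γ x) z = η x z := by
    intro γ x z hz
    conv_rhs => rw [← hPsum x]
    rw [map_sum, LinearMap.sum_apply]
    exact (Finset.sum_eq_single γ
      (fun δ _ hδ => horth δ γ hδ _ (hPmem δ x) z hz) (by simp)).symm
  have hPzero : ∀ γ δ, γ ≠ δ → ∀ y ∈ V_ δ, P γ y = 0 := by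
    intro γ δ hγδ y hy
    refine hndres γ _ (hPmem γ y) fun z hz => ?_
    rw [hPη γ y z hz]
    exact horth δ γ hγδ.symm y hy z hz
  have hPself : ∀ γ, ∀ y ∈ V_ γ, P γ y = y := by
    intro γ y hy
    conv_rhs => rw [← hPsum y]
    exact (Finset.sum_eq_single γ
      (fun δ _ hδ => hPzero δ γ hδ y hy) (by simp)).symm
  have hpU : ∀ y ∈ U, η p y = 0 := by
    have hle : U ≤ LinearMap.ker (η p) := by
      rw [hU]
      refine sup_le (iSup_le fun β y hy => ?_) ?_
      · exact horth _ _ (Fin.castSucc_lt_last β).ne' p hp y hy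
      · rw [Submodule.span_singleton_le_iff_mem]
        exact hpp
    exact fun y hy => hle hy
  ext x
  simp only [Set.mem_ofPred_eq, SetLike.mem_coe]
  constructor
  · intro hx
    have hPx : ∀ β : Fin n, P β.castSucc x = 0 := by
      intro β
      refine hndres _ _ (hPmem _ x) fun z hz => ?_
      obtain ⟨α, hα⟩ := hC β
      have hzU : z ∈ U := by
        rw [hU]
        exact Submodule.mem_sup_left
          (Submodule.mem_iSup_of_mem (p := fun β : Fin n => V_ β.castSucc) β hz)
      have h := hx α z hzU
      rw [hηbar, hpU z hzU, mul_zero, mul_zero, add_zero,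
        Finset.sum_eq_single β (fun δ _ hδ => by
          rw [hPzero _ _ (fun h => hδ (Fin.castSucc_injective n h)) z hz, map_zero, mul_zero])
          (by simp), hPself _ z hz] at h
      exact (mul_eq_zero.mp h).resolve_left hα
    have hxP : P (Fin.last n) x = x := by
      have h := hPsum x
      rwa [Fin.sum_univ_castSucc, Finset.sum_eq_zero fun β _ => hPx β, zero_add] at h
    exact hxP ▸ hPmem _ x
  · intro hx α y hy
    rw [hηbar, hpU y hy, mul_zero, mul_zero, add_zero]
    refine Finset.sum_eq_zero fun β _ => ?_
    rw [hPzero _ _ (Fin.castSucc_lt_last β).ne x hx, map_zero, LinearMap.zero_apply, mul_zero]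
end

section
/- (Uniqueness content of Proposition 2.) Let V be a finite-dimensional real vector space with a nondegenerate symmetric bilinear form η of Lorentzian signature, i.e. there exists v with η(v,v) < 0 and every subspace on which η is negative definite has dimension at most 1. Suppose V = V_1 ⊕ ⋯ ⊕ V_r and V = V'_1 ⊕ ⋯ ⊕ V'_r are two direct sum decompositions into nonzero pairwise η-orthogonal subspaces such that η restricted to V_β (resp. V'_β) is positive definite for 1 ≤ β ≤ r−1 and η restricted to V_r (resp. V'_r) is nondegenerate of Lorentzian signature; let p ∈ V_r and p' ∈ V'_r be nonzero vectors with η(p,p) = η(p',p') = 0, and set θ = η(p,·), θ' = η(p',·). Let η_α and η'_α denote the corresponding projected forms. If the linear span of {η_1, …, η_r, θ⊗θ} equals the linear span of {η'_1, …, η'_r, θ'⊗θ'} in the space of symmetric bilinear forms on V, then V'_r = V_r, ℝp' = ℝp, and there is a permutation σ of {1, …, r−1} with V'_α = V_{σ(α)} for all 1 ≤ α ≤ r−1. -/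
section OrthogonalProjections

variable {V : Type*} [AddCommGroup V] [Module ℝ V] {η : V →ₗ[ℝ] V →ₗ[ℝ] ℝ}
  {ι : Type*} [Fintype ι] {W : ι → Submodule ℝ V} {P : ι → V →ₗ[ℝ] V}

/-- Pairing with a vector of a factor only sees the component in that factor. -/
theorem form_apply_eq_form_proj (horth : ∀ α β, α ≠ β → ∀ x ∈ W α, ∀ y ∈ W β, η x y = 0)
    (hmem : ∀ α x, P α x ∈ W α) (hsum : ∀ x, ∑ α, P α x = x)
    {α : ι} {x : V} (hx : x ∈ W α) (y : V) : η x y = η x (P α y) := by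
  conv_lhs => rw [← hsum y, map_sum]
  exact Finset.sum_eq_single α
    (fun β _ hβ => horth α β hβ.symm x hx _ (hmem β y)) (by simp)

theorem proj_eq_zero_of_mem (hsymm : ∀ x y, η x y = η y x)
    (hnd : ∀ x, (∀ y, η x y = 0) → x = 0)
    (horth : ∀ α β, α ≠ β → ∀ x ∈ W α, ∀ y ∈ W β, η x y = 0)
    (hmem : ∀ α x, P α x ∈ W α) (hsum : ∀ x, ∑ α, P α x = x)
    {α β : ι} (hβ : β ≠ α) {x : V} (hx : x ∈ W α) : P β x = 0 := by
  refine hnd _ fun y => ?_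
  rw [form_apply_eq_form_proj horth hmem hsum (hmem β x), hsymm,
    ← form_apply_eq_form_proj horth hmem hsum (hmem β y)]
  exact horth β α hβ _ (hmem β y) x hx

theorem proj_eq_self_of_mem (hsymm : ∀ x y, η x y = η y x)
    (hnd : ∀ x, (∀ y, η x y = 0) → x = 0)
    (horth : ∀ α β, α ≠ β → ∀ x ∈ W α, ∀ y ∈ W β, η x y = 0)
    (hmem : ∀ α x, P α x ∈ W α) (hsum : ∀ x, ∑ α, P α x = x)
    {α : ι} {x : V} (hx : x ∈ W α) : P α x = x := by
  conv_rhs => rw [← hsum x]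
  exact (Finset.sum_eq_single α
    (fun β _ hβ => proj_eq_zero_of_mem hsymm hnd horth hmem hsum hβ hx) (by simp)).symm

/-- An endomorphism whose associated form lies in the span of the projected forms and `θ ⊗ θ`
is the corresponding combination of the projections and `p ⊗ θ`. -/
theorem exists_coeff_of_form_mem_span (hnd : ∀ x, (∀ y, η x y = 0) → x = 0)
    (horth : ∀ α β, α ≠ β → ∀ x ∈ W α, ∀ y ∈ W β, η x y = 0)
    (hmem : ∀ α x, P α x ∈ W α) (hsum : ∀ x, ∑ α, P α x = x)
    {p : V} {ηs : ι → V →ₗ[ℝ] V →ₗ[ℝ] ℝ} {T : V →ₗ[ℝ] V →ₗ[ℝ] ℝ}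
    (hηs : ∀ α x y, ηs α x y = η (P α x) (P α y)) (hT : ∀ x y, T x y = η p x * η p y)
    {B : V →ₗ[ℝ] V →ₗ[ℝ] ℝ} (hB : B ∈ Submodule.span ℝ (Set.range ηs ∪ {T}))
    {A : V → V} (hA : ∀ x y, B x y = η (A x) y) :
    ∃ (a : ι → ℝ) (b : ℝ), ∀ x, A x = ∑ i, a i • P i x + b • η p x • p := by
  rw [Submodule.span_union, Submodule.mem_sup] at hB
  obtain ⟨u, hu, v, hv, rfl⟩ := hB
  obtain ⟨a, rfl⟩ := (Submodule.mem_span_range_iff_exists_fun ℝ).1 hu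
  obtain ⟨b, rfl⟩ := Submodule.mem_span_singleton.1 hv
  refine ⟨a, b, fun x => sub_eq_zero.1 (hnd _ fun y => ?_)⟩
  have h := hA x y
  simp only [LinearMap.add_apply, LinearMap.sum_apply, LinearMap.smul_apply, smul_eq_mul, hηs, hT,
    ← form_apply_eq_form_proj horth hmem hsum (hmem _ x)] at h
  simp only [map_sub, map_add, map_sum, map_smul, LinearMap.sub_apply, LinearMap.add_apply,
    LinearMap.sum_apply, LinearMap.smul_apply, smul_eq_mul, ← h, sub_self]

/-- On the factor `W i`, the combination `∑ a i • P i + b • p ⊗ θ` is `a i • 1 + b • p ⊗ θ`. -/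
theorem apply_eq_of_mem (hsymm : ∀ x y, η x y = η y x)
    (hnd : ∀ x, (∀ y, η x y = 0) → x = 0)
    (horth : ∀ α β, α ≠ β → ∀ x ∈ W α, ∀ y ∈ W β, η x y = 0)
    (hmem : ∀ α x, P α x ∈ W α) (hsum : ∀ x, ∑ α, P α x = x)
    {p : V} {A : V → V} {a : ι → ℝ} {b : ℝ}
    (hA : ∀ x, A x = ∑ i, a i • P i x + b • η p x • p)
    {i : ι} {x : V} (hx : x ∈ W i) : A x = a i • x + b • η p x • p := by
  rw [hA, Finset.sum_eq_single i, proj_eq_self_of_mem hsymm hnd horth hmem hsum hx]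
  · intro j _ hj
    rw [proj_eq_zero_of_mem hsymm hnd horth hmem hsum hj hx, smul_zero]
  · simp

/-- An idempotent in the algebra spanned by the projections and `p ⊗ θ` acts on each factor
as the identity or as zero. -/
theorem idempotent_eq_self_or_eq_zero (hsymm : ∀ x y, η x y = η y x)
    (hnd : ∀ x, (∀ y, η x y = 0) → x = 0)
    (horth : ∀ α β, α ≠ β → ∀ x ∈ W α, ∀ y ∈ W β, η x y = 0)
    (hmem : ∀ α x, P α x ∈ W α) (hsum : ∀ x, ∑ α, P α x = x)
    {r : ι} {p : V} (hp : p ∈ W r) (hp0 : p ≠ 0) (hpp : η p p = 0)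
    {A : V →ₗ[ℝ] V} (hAA : ∀ x, A (A x) = A x) {a : ι → ℝ} {b : ℝ}
    (hA : ∀ x, A x = ∑ i, a i • P i x + b • η p x • p) (i : ι) :
    (∀ x ∈ W i, A x = x) ∨ (∀ x ∈ W i, A x = 0) := by
  have key {j : ι} {x : V} (hx : x ∈ W j) := apply_eq_of_mem hsymm hnd horth hmem hsum hA hx
  have scalar {j : ι} {x : V} (hx : x ∈ W j) (hx0 : x ≠ 0) (hpx : η p x = 0) :
      a j = 0 ∨ a j = 1 := by
    have h1 : A x = a j • x := by simpa [hpx] using key hx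
    have h2 := hAA x
    rw [h1, map_smul, h1, smul_smul] at h2
    have h3 : a j * (a j - 1) = 0 := by linarith [smul_left_injective ℝ hx0 h2]
    exact (mul_eq_zero.1 h3).imp_right sub_eq_zero.1
  have hAp : A p = a r • p := by simpa [hpp] using key hp
  have har : a r = 0 ∨ a r = 1 := scalar hp hp0 hpp
  have hb (x : V) (hx : x ∈ W i) : b * η p x = 0 := by
    by_cases hi : i = r
    · subst hi
      have h := hAA x
      rw [key hx, smul_smul, map_add, map_smul, map_smul, hAp, key hx] at h
      have h2 : (a i * (a i - 1)) • x + (b * η p x * (2 * a i - 1)) • p = 0 := by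
        rw [← sub_eq_zero] at h
        rw [← h]
        module
      have h3 : a i * (a i - 1) = 0 := by rcases har with h | h <;> simp [h]
      rw [h3, zero_smul, zero_add] at h2
      have h4 := (smul_eq_zero.1 h2).resolve_right hp0
      rcases har with h | h <;> rw [h] at h4 <;> linarith
    · rw [horth r i (Ne.symm hi) p hp x hx, mul_zero]
  have hAx (x : V) (hx : x ∈ W i) : A x = a i • x := by
    rw [key hx, smul_smul, hb x hx, zero_smul, add_zero]
  have hai : a i = 0 ∨ a i = 1 ∨ ∀ x ∈ W i, x = 0 := by
    by_cases hi : i = r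
    · subst hi; tauto
    by_cases h : ∀ x ∈ W i, x = 0
    · exact Or.inr (Or.inr h)
    push Not at h
    obtain ⟨x, hx, hx0⟩ := h
    have := scalar hx hx0 (horth r i (Ne.symm hi) p hp x hx)
    tauto
  rcases hai with h | h | h
  · exact Or.inr fun x hx => by rw [hAx x hx, h, zero_smul]
  · exact Or.inl fun x hx => by rw [hAx x hx, h, one_smul]
  · exact Or.inl fun x hx => by rw [h x hx, map_zero]

/-- A square-zero element of the algebra spanned by the projections and `p ⊗ θ` is a multiple
of `p ⊗ θ`. -/
theorem apply_mem_span_of_sq_zero (hsymm : ∀ x y, η x y = η y x)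
    (hnd : ∀ x, (∀ y, η x y = 0) → x = 0)
    (horth : ∀ α β, α ≠ β → ∀ x ∈ W α, ∀ y ∈ W β, η x y = 0)
    (hmem : ∀ α x, P α x ∈ W α) (hsum : ∀ x, ∑ α, P α x = x)
    {r : ι} {p : V} (hp : p ∈ W r) (hp0 : p ≠ 0) (hpp : η p p = 0)
    {A : V →ₗ[ℝ] V} (hAA : ∀ x, A (A x) = 0) {a : ι → ℝ} {b : ℝ}
    (hA : ∀ x, A x = ∑ i, a i • P i x + b • η p x • p) (x : V) :
    A x ∈ Submodule.span ℝ {p} := by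
  have scalar {j : ι} {x : V} (hx : x ∈ W j) (hx0 : x ≠ 0) (hpx : η p x = 0) : a j = 0 := by
    have h1 : A x = a j • x := by
      simpa [hpx] using apply_eq_of_mem hsymm hnd horth hmem hsum hA hx
    have h2 := hAA x
    rw [h1, map_smul, h1, smul_smul] at h2
    exact mul_self_eq_zero.1 ((smul_eq_zero.1 h2).resolve_right hx0)
  rw [hA]
  refine add_mem (sum_mem fun i _ => ?_) (Submodule.smul_mem _ _
    (Submodule.smul_mem _ _ (Submodule.mem_span_singleton_self p)))
  suffices a i • P i x = 0 by rw [this]; exact zero_mem _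
  by_cases hi : i = r
  · subst hi; rw [scalar hp hp0 hpp, zero_smul]
  by_cases h : P i x = 0
  · rw [h, smul_zero]
  · rw [scalar (hmem i x) h (horth r i (Ne.symm hi) p hp _ (hmem i x)), zero_smul]

/-- If each projection of the second decomposition is the identity or zero on each factor of the
first one, then the two decompositions agree up to a permutation. -/
theorem exists_equiv_of_eq_self_or_eq_zero {W' : ι → Submodule ℝ V} {P' : ι → V →ₗ[ℝ] V}
    (hne : ∀ α, W α ≠ ⊥) (hne' : ∀ α, W' α ≠ ⊥) (hsum : ∀ x, ∑ α, P α x = x)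
    (hmem : ∀ α x, P α x ∈ W α)
    (hmem' : ∀ α x, P' α x ∈ W' α) (hsum' : ∀ x, ∑ α, P' α x = x)
    (hself : ∀ α, ∀ x ∈ W' α, P' α x = x)
    (hzero : ∀ α β, β ≠ α → ∀ x ∈ W' α, P' β x = 0)
    (h : ∀ α i, (∀ x ∈ W i, P' α x = x) ∨ (∀ x ∈ W i, P' α x = 0)) :
    ∃ e : ι ≃ ι, ∀ α, W' α = W (e α) := by
  have hex (i : ι) : ∃ α, W i ≤ W' α := by
    by_contra! hcon
    obtain ⟨x, hx, hx0⟩ := Submodule.exists_mem_ne_zero_of_ne_bot (hne i)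
    refine hx0 ?_
    rw [← hsum' x]
    refine Finset.sum_eq_zero fun α _ => (h α i).elim (fun h1 => ?_) (fun h1 => h1 x hx)
    exact absurd (fun y hy => h1 y hy ▸ hmem' α y) (hcon α)
  choose g hg using hex
  have huniq {i α : ι} (hi : ¬ ∀ x ∈ W i, P' α x = 0) : g i = α := by
    by_contra hne
    exact hi fun x hx => hzero (g i) α (Ne.symm hne) x (hg i hx)
  have hsurj : Function.Surjective g := by
    intro α
    by_contra! hcon
    obtain ⟨x, hx, hx0⟩ := Submodule.exists_mem_ne_zero_of_ne_bot (hne' α)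
    refine hx0 ?_
    rw [← hself α x hx, ← hsum x, map_sum]
    exact Finset.sum_eq_zero fun i _ =>
      of_not_not (fun hi => hcon i (huniq fun h0 => hi (h0 _ (hmem i x))))
  let e := Equiv.ofBijective g ⟨Finite.injective_iff_surjective.2 hsurj, hsurj⟩
  have hge (α : ι) : g (e.symm α) = α := e.apply_symm_apply α
  refine ⟨e.symm, fun α => le_antisymm (fun x hx => ?_) ?_⟩
  · rw [← hself α x hx, ← hsum x, map_sum]
    refine sum_mem fun i _ => ?_
    rcases h α i with h1 | h1
    · rw [h1 _ (hmem i x)]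
      by_cases hi : g i = α
      · have : e.symm α = i := by rw [← hi]; exact e.symm_apply_apply i
        rw [this]; exact hmem i x
      · have h0 : P' α (P i x) = 0 := hzero (g i) α (Ne.symm hi) _ (hg i (hmem i x))
        rw [← h1 _ (hmem i x), h0]; exact zero_mem _
    · rw [h1 _ (hmem i x)]; exact zero_mem _
  · simpa only [hge] using hg (e.symm α)

end OrthogonalProjections

/-- Uniqueness content of Proposition 2: two decompositions of a Lorentzian vector
space into nonzero pairwise orthogonal subspaces (positive definite on the first
`r−1` factors, Lorentzian on the last one), together with light-like vectors
`p`, `p'` in the last factors, whose associated families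
`{η_1, …, η_r, θ⊗θ}` and `{η'_1, …, η'_r, θ'⊗θ'}` have equal linear spans, agree:
the Lorentzian factors coincide, `ℝ p' = ℝ p`, and the Riemannian factors agree up
to a permutation. Here the subspaces are indexed by `Fin (n+1)`, `Fin.last n`
playing the role of `r` and `β.castSucc` for `β : Fin n` the roles of `1,…,r−1`. -/
theorem wu_decomposition_unique
    {V : Type*} [AddCommGroup V] [Module ℝ V] [FiniteDimensional ℝ V]
    (η : V →ₗ[ℝ] V →ₗ[ℝ] ℝ)
    (hsymm : ∀ x y, η x y = η y x)
    (hnd : ∀ x, (∀ y, η x y = 0) → x = 0)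
    -- `η` has Lorentzian signature
    (htime : ∃ v, η v v < 0)
    (hlor : ∀ W : Submodule ℝ V, (∀ x ∈ W, x ≠ 0 → η x x < 0) → Module.finrank ℝ W ≤ 1)
    {n : ℕ}
    -- the two decompositions
    (V₁ : Fin (n + 1) → Submodule ℝ V) (V₂ : Fin (n + 1) → Submodule ℝ V)
    (hint₁ : DirectSum.IsInternal V₁) (hint₂ : DirectSum.IsInternal V₂)
    (hne₁ : ∀ α, V₁ α ≠ ⊥) (hne₂ : ∀ α, V₂ α ≠ ⊥)
    (horth₁ : ∀ α β, α ≠ β → ∀ x ∈ V₁ α, ∀ y ∈ V₁ β, η x y = 0)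
    (horth₂ : ∀ α β, α ≠ β → ∀ x ∈ V₂ α, ∀ y ∈ V₂ β, η x y = 0)
    -- `η` is positive definite on the first `r − 1` factors
    (hpos₁ : ∀ β : Fin n, ∀ x ∈ V₁ β.castSucc, x ≠ 0 → 0 < η x x)
    (hpos₂ : ∀ β : Fin n, ∀ x ∈ V₂ β.castSucc, x ≠ 0 → 0 < η x x)
    -- `η` is nondegenerate of Lorentzian signature on the last factor
    (hndr₁ : ∀ x ∈ V₁ (Fin.last n), (∀ y ∈ V₁ (Fin.last n), η x y = 0) → x = 0)
    (hndr₂ : ∀ x ∈ V₂ (Fin.last n), (∀ y ∈ V₂ (Fin.last n), η x y = 0) → x = 0)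
    (htime₁ : ∃ v ∈ V₁ (Fin.last n), η v v < 0)
    (htime₂ : ∃ v ∈ V₂ (Fin.last n), η v v < 0)
    (hlor₁ : ∀ W : Submodule ℝ V, W ≤ V₁ (Fin.last n) →
      (∀ x ∈ W, x ≠ 0 → η x x < 0) → Module.finrank ℝ W ≤ 1)
    (hlor₂ : ∀ W : Submodule ℝ V, W ≤ V₂ (Fin.last n) →
      (∀ x ∈ W, x ≠ 0 → η x x < 0) → Module.finrank ℝ W ≤ 1)
    -- the light-like vectors in the last factors
    (p₁ : V) (hp₁ : p₁ ∈ V₁ (Fin.last n)) (hp₁0 : p₁ ≠ 0) (hpp₁ : η p₁ p₁ = 0)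
    (p₂ : V) (hp₂ : p₂ ∈ V₂ (Fin.last n)) (hp₂0 : p₂ ≠ 0) (hpp₂ : η p₂ p₂ = 0)
    -- the projections onto the subspaces along the decompositions
    (P₁ : Fin (n + 1) → V →ₗ[ℝ] V) (P₂ : Fin (n + 1) → V →ₗ[ℝ] V)
    (hP₁mem : ∀ α x, P₁ α x ∈ V₁ α) (hP₁sum : ∀ x, ∑ α, P₁ α x = x)
    (hP₂mem : ∀ α x, P₂ α x ∈ V₂ α) (hP₂sum : ∀ x, ∑ α, P₂ α x = x)
    -- the projected forms and the forms `θ⊗θ`, `θ'⊗θ'`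
    (ηs₁ : Fin (n + 1) → V →ₗ[ℝ] V →ₗ[ℝ] ℝ) (ηs₂ : Fin (n + 1) → V →ₗ[ℝ] V →ₗ[ℝ] ℝ)
    (hηs₁ : ∀ α x y, ηs₁ α x y = η (P₁ α x) (P₁ α y))
    (hηs₂ : ∀ α x y, ηs₂ α x y = η (P₂ α x) (P₂ α y))
    (T₁ : V →ₗ[ℝ] V →ₗ[ℝ] ℝ) (hT₁ : ∀ x y, T₁ x y = η p₁ x * η p₁ y)
    (T₂ : V →ₗ[ℝ] V →ₗ[ℝ] ℝ) (hT₂ : ∀ x y, T₂ x y = η p₂ x * η p₂ y)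
    -- the spans coincide
    (hspan : Submodule.span ℝ (Set.range ηs₁ ∪ {T₁}) =
      Submodule.span ℝ (Set.range ηs₂ ∪ {T₂})) :
    V₂ (Fin.last n) = V₁ (Fin.last n) ∧
      Submodule.span ℝ {p₂} = Submodule.span ℝ {p₁} ∧
      ∃ σ : Fin n ≃ Fin n, ∀ α : Fin n, V₂ α.castSucc = V₁ (σ α).castSucc := by
  have hself₁ {α} {x : V} (hx : x ∈ V₁ α) : P₁ α x = x :=
    proj_eq_self_of_mem hsymm hnd horth₁ hP₁mem hP₁sum hx
  have hself₂ (α) (x : V) (hx : x ∈ V₂ α) : P₂ α x = x :=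
    proj_eq_self_of_mem hsymm hnd horth₂ hP₂mem hP₂sum hx
  have hidem (α i) : (∀ x ∈ V₁ i, P₂ α x = x) ∨ (∀ x ∈ V₁ i, P₂ α x = 0) := by
    have hB : ηs₂ α ∈ Submodule.span ℝ (Set.range ηs₁ ∪ {T₁}) :=
      hspan ▸ Submodule.subset_span (Or.inl ⟨α, rfl⟩)
    obtain ⟨a, b, hab⟩ := exists_coeff_of_form_mem_span (A := P₂ α) hnd horth₁ hP₁mem hP₁sum
      hηs₁ hT₁ hB fun x y => by
        rw [hηs₂, ← form_apply_eq_form_proj horth₂ hP₂mem hP₂sum (hP₂mem α x)]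
    exact idempotent_eq_self_or_eq_zero hsymm hnd horth₁ hP₁mem hP₁sum hp₁ hp₁0 hpp₁
      (fun x => hself₂ α _ (hP₂mem α x)) hab i
  obtain ⟨e, he⟩ := exists_equiv_of_eq_self_or_eq_zero hne₁ hne₂ hP₁sum hP₁mem hP₂mem hP₂sum
    hself₂ (fun α β hβ x hx => proj_eq_zero_of_mem hsymm hnd horth₂ hP₂mem hP₂sum hβ hx) hidem
  have hp₂span : p₂ ∈ Submodule.span ℝ {p₁} := by
    have hB : T₂ ∈ Submodule.span ℝ (Set.range ηs₁ ∪ {T₁}) :=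
      hspan ▸ Submodule.subset_span (Or.inr rfl)
    let N : V →ₗ[ℝ] V := (η p₂).smulRight p₂
    obtain ⟨a, b, hab⟩ := exists_coeff_of_form_mem_span (A := N) hnd horth₁ hP₁mem hP₁sum
      hηs₁ hT₁ hB fun x y => by simp [N, hT₂]
    obtain ⟨x, hx⟩ : ∃ x, η p₂ x ≠ 0 := by
      by_contra! hcon
      exact hp₂0 (hnd _ hcon)
    have hN : η p₂ x • p₂ ∈ Submodule.span ℝ {p₁} :=
      apply_mem_span_of_sq_zero hsymm hnd horth₁ hP₁mem hP₁sum hp₁ hp₁0 hpp₁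
        (fun x => by simp [N, hpp₂]) hab x
    exact (Submodule.smul_mem_iff _ hx).1 hN
  have hlast : e (Fin.last n) = Fin.last n := by
    by_contra hcon
    have hmem : p₂ ∈ V₁ (e (Fin.last n)) := he _ ▸ hp₂
    have hmem' : p₂ ∈ V₁ (Fin.last n) :=
      (Submodule.span_singleton_le_iff_mem p₁ _).2 hp₁ hp₂span
    refine hp₂0 ?_
    rw [← hself₁ hmem']
    exact proj_eq_zero_of_mem hsymm hnd horth₁ hP₁mem hP₁sum (Ne.symm hcon) hmem
  have hne_last (f : Fin (n + 1) ≃ Fin (n + 1)) (hf : f (Fin.last n) = Fin.last n)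
      (α : Fin n) : f α.castSucc ≠ Fin.last n := fun h =>
    Fin.castSucc_ne_last α (f.injective (h.trans hf.symm))
  have hlast' : e.symm (Fin.last n) = Fin.last n := e.symm_apply_eq.2 hlast.symm
  refine ⟨by rw [he, hlast], ?_,
    { toFun := fun α => (e α.castSucc).castPred (hne_last e hlast α)
      invFun := fun α => (e.symm α.castSucc).castPred (hne_last e.symm hlast' α)
      left_inv := fun α => by simp
      right_inv := fun α => by simp }, fun α => by simp [he]⟩
  obtain ⟨c, rfl⟩ := Submodule.mem_span_singleton.1 hp₂span
  exact Submodule.span_singleton_smul_eq (IsUnit.mk0 c (left_ne_zero_of_smul hp₂0)) p₁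
end
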